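/- Linear head normal forms are tightly typable: let t be a linear head normal form (normal_ℓh(t)). Then there exists a tight typing derivation Φ ▷^(0,0,|t|_ℓh) Γ ⊢ t : τ in system ℓ. Moreover, if t is linear head neutral (neutral_ℓh(t)) then τ = neutral, and if t is a linear head abstraction (abs_ℓh(t)) then τ = abs. -/

import Mathlib

/-! Linear substitution calculus (LSC) and the multi type system ℓ. -/

namespace LSC

/-- Terms of the linear substitution calculus:
variables, abstractions, applications and explicit substitutions `t[x\u]`. -/
inductive Term : Type
  | var : ℕ → Term
  | lam : ℕ → Term → Term
  | app : Term → Term → Term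
  | es  : Term → ℕ → Term → Term

/-- Free variables of a term. -/
def fv : Term → Finset ℕ
  | Term.var x => {x}
  | Term.lam x t => fv t \ {x}
  | Term.app t u => fv t ∪ fv u
  | Term.es t x u => (fv t \ {x}) ∪ fv u

/-- Multi types: the two tight constants and arrow types whose source is a
finite multiset (represented as a list) of multi types. -/
inductive Ty : Type
  | neutral : Ty
  | abs : Ty
  | arrow : List Ty → Ty → Ty

/-- A type is tight when it is one of the two tight constants. -/
def tightTy (τ : Ty) : Prop := τ = Ty.neutral ∨ τ = Ty.abs

/-- A multiset of types is tight when all its elements are tight. -/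
def tightM (M : List Ty) : Prop := ∀ τ ∈ M, tightTy τ

/-- Typing contexts: maps from variables to finite multisets of types
(the empty multiset meaning that the variable is not in the domain). -/
def Ctx : Type := ℕ → List Ty

/-- Multiset union of typing contexts. -/
def Ctx.union (Γ Δ : Ctx) : Ctx := fun x => Γ x ++ Δ x

/-- Removing a variable from a typing context. -/
def Ctx.erase (Γ : Ctx) (x : ℕ) : Ctx := fun y => if y = x then [] else Γ y

/-- The typing context `x : M`. -/
def Ctx.single (x : ℕ) (M : List Ty) : Ctx := fun y => if y = x then M else []

/-- The empty typing context. -/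
def Ctx.empty : Ctx := fun _ => []

/-- A typing context is tight when all its multisets are tight. -/
def tightCtx (Γ : Ctx) : Prop := ∀ x, tightM (Γ x)

mutual
  /-- The type system ℓ: `Deriv Γ t τ b e r s` means that there is a typing
  derivation `Φ ▷^(b,e,r) Γ ⊢ t : τ` whose size (number of rules, not counting
  occurrences of the rule `many`) is `s`.  The index `r − |M|` of the rules
  `λ_b` and `ES` is rendered by writing the premise index as `r + |M|`. -/
  inductive Deriv : Ctx → Term → Ty → ℕ → ℕ → ℕ → ℕ → Prop
    | ax {x : ℕ} {τ : Ty} :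
        Deriv (Ctx.single x [τ]) (Term.var x) τ 0 0 1 1
    | lamB {Γ : Ctx} {x : ℕ} {t : Term} {τ : Ty} {b e r s : ℕ} :
        Deriv Γ t τ b e (r + (Γ x).length) s →
        Deriv (Γ.erase x) (Term.lam x t) (Ty.arrow (Γ x) τ)
          (b + 1) (e + (Γ x).length) r (s + 1)
    | lamR {Γ : Ctx} {x : ℕ} {t : Term} {τ : Ty} {b e r s : ℕ} :
        tightM (Γ x) → tightTy τ →
        Deriv Γ t τ b e r s →
        Deriv (Γ.erase x) (Term.lam x t) Ty.abs b e (r + 1) (s + 1)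
    | appB {Γ Δ : Ctx} {t u : Term} {M : List Ty} {τ : Ty} {b e r s b' e' r' s' : ℕ} :
        Deriv Γ t (Ty.arrow M τ) b e r s →
        DerivM Δ u M b' e' r' s' →
        Deriv (Γ.union Δ) (Term.app t u) τ (b + b' + 1) (e + e') (r + r') (s + s' + 1)
    | appR {Γ : Ctx} {t u : Term} {b e r s : ℕ} :
        Deriv Γ t Ty.neutral b e r s →
        Deriv Γ (Term.app t u) Ty.neutral b e (r + 1) (s + 1)
    | esR {Γ Δ : Ctx} {t : Term} {x : ℕ} {u : Term} {τ : Ty} {b e r s b' e' r' s' : ℕ} :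
        Deriv Γ t τ b e (r + (Γ x).length) s →
        DerivM Δ u (Γ x) b' e' r' s' →
        Deriv ((Γ.erase x).union Δ) (Term.es t x u) τ
          (b + b') (e + e' + (Γ x).length) (r + r') (s + s' + 1)

  /-- The rule `many`: a finite family of derivations typing the same term is
  merged, summing contexts and indices, to type it with the multiset of the types. -/
  inductive DerivM : Ctx → Term → List Ty → ℕ → ℕ → ℕ → ℕ → Prop
    | nil {t : Term} : DerivM Ctx.empty t [] 0 0 0 0
    | cons {Γ Δ : Ctx} {t : Term} {τ : Ty} {M : List Ty} {b e r s b' e' r' s' : ℕ} :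
        Deriv Γ t τ b e r s →
        DerivM Δ t M b' e' r' s' →
        DerivM (Γ.union Δ) t (τ :: M) (b + b') (e + e') (r + r') (s + s')
end

/-- `NeutralAt x t`: the predicate `neutral_x(t)` (linear head neutral with head
variable `x`). -/
inductive NeutralAt : ℕ → Term → Prop
  | var (x : ℕ) : NeutralAt x (Term.var x)
  | app {x : ℕ} {t : Term} (u : Term) : NeutralAt x t → NeutralAt x (Term.app t u)
  | es {x y : ℕ} {t : Term} (u : Term) : NeutralAt x t → y ≠ x →
      NeutralAt x (Term.es t y u)

/-- `NormalAt x t`: the predicate `normal_x(t)` (linear head normal with free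
head variable `x`). -/
inductive NormalAt : ℕ → Term → Prop
  | neutral {x : ℕ} {t : Term} : NeutralAt x t → NormalAt x t
  | lam {x y : ℕ} {t : Term} : NormalAt x t → y ≠ x → NormalAt x (Term.lam y t)
  | es {x y : ℕ} {t : Term} (u : Term) : NormalAt x t → y ≠ x →
      NormalAt x (Term.es t y u)

/-- `NormalO t`: the predicate `normal°(t)` (linear head normal with bound head
variable). -/
inductive NormalO : Term → Prop
  | lamAt {x : ℕ} {t : Term} : NormalAt x t → NormalO (Term.lam x t)
  | lamO {x : ℕ} {t : Term} : NormalO t → NormalO (Term.lam x t)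
  | es {y : ℕ} {t : Term} (u : Term) : NormalO t → NormalO (Term.es t y u)

/-- Linear head normal forms. -/
def NormalLH (t : Term) : Prop := (∃ x, NormalAt x t) ∨ NormalO t

/-- Linear head neutral terms. -/
def NeutralLH (t : Term) : Prop := ∃ x, NeutralAt x t

/-- Linear head abstractions (`abs_ℓh`), i.e. abstractions modulo ES. -/
inductive AbsLH : Term → Prop
  | lam {x : ℕ} {t : Term} : AbsLH (Term.lam x t)
  | es {x : ℕ} {t u : Term} : AbsLH t → AbsLH (Term.es t x u)

/-- Linear head size. -/
def lhSize : Term → ℕ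
  | Term.var _ => 1
  | Term.lam _ t => lhSize t + 1
  | Term.app t _ => lhSize t + 1
  | Term.es t _ _ => lhSize t

/-- Linear head contexts `H ::= ⟨·⟩ | λx.H | H t | H[x\t]`. -/
inductive HCtx : Type
  | hole : HCtx
  | lam : ℕ → HCtx → HCtx
  | app : HCtx → Term → HCtx
  | es : HCtx → ℕ → Term → HCtx

/-- Plugging a term in a linear head context. -/
def HCtx.plug : HCtx → Term → Term
  | HCtx.hole, t => t
  | HCtx.lam x H, t => Term.lam x (H.plug t)
  | HCtx.app H u, t => Term.app (H.plug t) u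
  | HCtx.es H x u, t => Term.es (H.plug t) x u

/-- The variables that a linear head context can capture. -/
def HCtx.binders : HCtx → Finset ℕ
  | HCtx.hole => ∅
  | HCtx.lam x H => insert x H.binders
  | HCtx.app H _ => H.binders
  | HCtx.es H x _ => insert x H.binders

/-- Substitution contexts `L ::= ⟨·⟩ | L[x\t]`. -/
inductive LCtx : Type
  | hole : LCtx
  | es : LCtx → ℕ → Term → LCtx

/-- Plugging a term in a substitution context. -/
def LCtx.plug : LCtx → Term → Term
  | LCtx.hole, t => t
  | LCtx.es L x u, t => Term.es (L.plug t) x u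

/-- `t` is of the form `H⟨x⟩` with `x` not captured by `H`. -/
def IsHeadVarOf (x : ℕ) (t : Term) : Prop :=
  ∃ H : HCtx, x ∉ H.binders ∧ t = H.plug (Term.var x)

/-- Multiplicative evaluation `→m`. -/
inductive MStep : Term → Term → Prop
  | beta {L : LCtx} {x : ℕ} {t u : Term} :
      MStep (Term.app (L.plug (Term.lam x t)) u) (L.plug (Term.es t x u))
  | lam {x : ℕ} {t t' : Term} : MStep t t' → MStep (Term.lam x t) (Term.lam x t')
  | app {t t' u : Term} : ¬ AbsLH t → MStep t t' →
      MStep (Term.app t u) (Term.app t' u)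
  | es {t t' u : Term} {x : ℕ} : ¬ IsHeadVarOf x t → MStep t t' →
      MStep (Term.es t x u) (Term.es t' x u)

/-- Exponential evaluation `→e`. -/
inductive EStep : Term → Term → Prop
  | sub {H : HCtx} {x : ℕ} {u : Term} :
      x ∉ H.binders → (∀ y ∈ fv u, y ∉ H.binders) →
      EStep (Term.es (H.plug (Term.var x)) x u) (Term.es (H.plug u) x u)
  | lam {x : ℕ} {t t' : Term} : EStep t t' → EStep (Term.lam x t) (Term.lam x t')
  | app {t t' u : Term} : ¬ AbsLH t → EStep t t' →
      EStep (Term.app t u) (Term.app t' u)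
  | es {t t' u : Term} {x : ℕ} : ¬ IsHeadVarOf x t → EStep t t' →
      EStep (Term.es t x u) (Term.es t' x u)

/-- Linear head evaluation `→ℓh` is the union of `→m` and `→e`. -/
def LHStep (t u : Term) : Prop := MStep t u ∨ EStep t u

/-- `Steps R k t u`: `t` evaluates to `u` in exactly `k` `R`-steps. -/
def Steps (R : Term → Term → Prop) : ℕ → Term → Term → Prop
  | 0, t, u => t = u
  | k + 1, t, u => ∃ p, R t p ∧ Steps R k p u

/-- `MESteps k₁ k₂ t u`: an evaluation sequence from `t` to `u` made of `k₁`
multiplicative steps and `k₂` exponential steps. -/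
inductive MESteps : ℕ → ℕ → Term → Term → Prop
  | refl (t : Term) : MESteps 0 0 t t
  | mstep {t p u : Term} {k₁ k₂ : ℕ} : MStep t p → MESteps k₁ k₂ p u →
      MESteps (k₁ + 1) k₂ t u
  | estep {t p u : Term} {k₁ k₂ : ℕ} : EStep t p → MESteps k₁ k₂ p u →
      MESteps k₁ (k₂ + 1) t u


theorem Ctx.erase_of_eq_nil {Γ : Ctx} {y : ℕ} (h : Γ y = []) : Γ.erase y = Γ := by
  funext z
  by_cases hz : z = y
  · subst hz; simp [Ctx.erase, h]
  · simp [Ctx.erase, hz]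

theorem Ctx.union_empty (Γ : Ctx) : Γ.union Ctx.empty = Γ := by
  funext z
  simp [Ctx.union, Ctx.empty]

theorem Ctx.erase_single (x : ℕ) (M : List Ty) : (Ctx.single x M).erase x = Ctx.empty := by
  funext z
  by_cases hz : z = x <;> simp [Ctx.erase, Ctx.single, Ctx.empty, hz]

theorem Ctx.single_of_ne {x y : ℕ} (h : y ≠ x) (M : List Ty) : Ctx.single x M y = [] := by
  simp [Ctx.single, h]

theorem tightCtx_empty : tightCtx Ctx.empty := by
  intro x τ h
  simp [Ctx.empty] at h

theorem tightCtx_single {x : ℕ} {M : List Ty} (hM : tightM M) : tightCtx (Ctx.single x M) := by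
  intro y τ h
  by_cases hy : y = x
  · exact hM τ (by simpa [Ctx.single, hy] using h)
  · simp [Ctx.single, hy] at h

theorem tightM_singleton_neutral : tightM [Ty.neutral] := by
  intro τ h
  exact Or.inl (by simpa using h)

/-- An explicit substitution on a variable outside the context is typed with an empty
`many` rule. -/
theorem Deriv.es_of_eq_nil {Γ : Ctx} {t : Term} {τ : Ty} {b e r s y : ℕ} (u : Term)
    (h : Deriv Γ t τ b e r s) (hy : Γ y = []) :
    Deriv Γ (Term.es t y u) τ b e r (s + 1) := by
  have h₁ : Deriv Γ t τ b e (r + (Γ y).length) s := by simpa [hy] using h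
  have h₂ : DerivM Ctx.empty u (Γ y) 0 0 0 0 := by rw [hy]; exact DerivM.nil
  simpa [hy, Ctx.erase_of_eq_nil hy, Ctx.union_empty] using Deriv.esR h₁ h₂

theorem NeutralAt.exists_deriv {x : ℕ} {t : Term} (h : NeutralAt x t) :
    ∃ s, Deriv (Ctx.single x [Ty.neutral]) t Ty.neutral 0 0 (lhSize t) s := by
  induction h with
  | var => exact ⟨1, Deriv.ax⟩
  | app u _ ih =>
    obtain ⟨s, hs⟩ := ih
    exact ⟨s + 1, Deriv.appR hs⟩
  | es u _ hne ih =>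
    obtain ⟨s, hs⟩ := ih
    exact ⟨s + 1, hs.es_of_eq_nil u (Ctx.single_of_ne hne _)⟩

theorem exists_deriv_of_neutralAt_or {x : ℕ} {t : Term}
    (h : NeutralAt x t ∨
      AbsLH t ∧ ∃ s, Deriv (Ctx.single x [Ty.neutral]) t Ty.abs 0 0 (lhSize t) s) :
    ∃ τ s, tightTy τ ∧ Deriv (Ctx.single x [Ty.neutral]) t τ 0 0 (lhSize t) s := by
  rcases h with hn | ⟨_, s, hs⟩
  · obtain ⟨s, hs⟩ := hn.exists_deriv
    exact ⟨_, s, Or.inl rfl, hs⟩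
  · exact ⟨_, s, Or.inr rfl, hs⟩

theorem NormalAt.neutralAt_or_exists_deriv {x : ℕ} {t : Term} (h : NormalAt x t) :
    NeutralAt x t ∨
      AbsLH t ∧ ∃ s, Deriv (Ctx.single x [Ty.neutral]) t Ty.abs 0 0 (lhSize t) s := by
  induction h with
  | neutral h => exact Or.inl h
  | @lam y t _ hne ih =>
    have hy := Ctx.single_of_ne hne [Ty.neutral]
    have hM : tightM (Ctx.single x [Ty.neutral] y) := tightCtx_single tightM_singleton_neutral y
    refine Or.inr ⟨AbsLH.lam, ?_⟩
    obtain ⟨τ, s, hτ, hs⟩ := exists_deriv_of_neutralAt_or ih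
    have hl := Deriv.lamR hM hτ hs
    rw [Ctx.erase_of_eq_nil hy] at hl
    exact ⟨s + 1, hl⟩
  | es u _ hne ih =>
    rcases ih with hn | ⟨ha, s, hs⟩
    · exact Or.inl (NeutralAt.es u hn hne)
    · exact Or.inr ⟨AbsLH.es ha, s + 1, hs.es_of_eq_nil u (Ctx.single_of_ne hne _)⟩

theorem NormalO.exists_deriv {t : Term} (h : NormalO t) :
    ∃ s, Deriv Ctx.empty t Ty.abs 0 0 (lhSize t) s := by
  induction h with
  | @lamAt x t h =>
    obtain ⟨τ, s, hτ, hs⟩ := exists_deriv_of_neutralAt_or h.neutralAt_or_exists_deriv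
    have hl := Deriv.lamR (x := x) (tightCtx_single tightM_singleton_neutral x) hτ hs
    rw [Ctx.erase_single] at hl
    exact ⟨s + 1, hl⟩
  | @lamO x t _ ih =>
    obtain ⟨s, hs⟩ := ih
    have hl := Deriv.lamR (x := x) (tightCtx_empty x) (Or.inr rfl) hs
    rw [Ctx.erase_of_eq_nil rfl] at hl
    exact ⟨s + 1, hl⟩
  | es u _ ih =>
    obtain ⟨s, hs⟩ := ih
    exact ⟨s + 1, hs.es_of_eq_nil u rfl⟩

theorem NormalO.absLH {t : Term} (h : NormalO t) : AbsLH t := by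
  induction h with
  | lamAt _ => exact AbsLH.lam
  | lamO _ _ => exact AbsLH.lam
  | es _ _ ih => exact AbsLH.es ih

theorem AbsLH.not_neutralLH {t : Term} (h : AbsLH t) : ¬ NeutralLH t := by
  induction h with
  | lam => rintro ⟨x, hx⟩; cases hx
  | es _ ih =>
    rintro ⟨x, hx⟩
    cases hx with
    | es _ hn _ => exact ih ⟨x, hn⟩

/-- Linear head normal forms are tightly typable in system ℓ. -/
theorem lsc_normal_forms_tightly_typable
    {t : Term} (ht : NormalLH t) :
    ∃ (Γ : Ctx) (τ : Ty) (s : ℕ),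
      Deriv Γ t τ 0 0 (lhSize t) s ∧
      tightTy τ ∧ tightCtx Γ ∧
      (NeutralLH t → τ = Ty.neutral) ∧
      (AbsLH t → τ = Ty.abs) := by
  rcases ht with ⟨x, hx⟩ | ho
  · have hΓ : tightCtx (Ctx.single x [Ty.neutral]) := tightCtx_single tightM_singleton_neutral
    rcases hx.neutralAt_or_exists_deriv with hn | ⟨ha, s, hs⟩
    · obtain ⟨s, hs⟩ := hn.exists_deriv
      exact ⟨_, _, s, hs, Or.inl rfl, hΓ, fun _ => rfl,
        fun ha => absurd ⟨x, hn⟩ ha.not_neutralLH⟩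
    · exact ⟨_, _, s, hs, Or.inr rfl, hΓ, fun hn => absurd hn ha.not_neutralLH, fun _ => rfl⟩
  · obtain ⟨s, hs⟩ := ho.exists_deriv
    exact ⟨_, _, s, hs, Or.inr rfl, tightCtx_empty,
      fun hn => absurd hn ho.absLH.not_neutralLH, fun _ => rfl⟩

end LSC
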